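/- Let (B,·,∘) be a skew left brace and (B,λ,ρ) its associated solution. Then: (i) λ_{λ_x(y)} = λ_y holds for all x,y ∈ B if and only if λ_{x·y} = λ_xλ_y for all x,y ∈ B (λ is a homomorphism from (B,·) to Aut(B,·)); (ii) ρ_{ρ_x(y)} = ρ_y holds for all x,y ∈ B if and only if ρ_{x·y} = ρ_xρ_y for all x,y ∈ B (ρ is a homomorphism from (B,·) to Sym(B)); (iii) λ_{ρ_x(y)} = λ_y holds for all x,y ∈ B if and only if λ_{x·y} = λ_yλ_x for all x,y ∈ B (λ is an anti-homomorphism from (B,·) to Aut(B,·)); (iv) ρ_{λ_x(y)} = ρ_y holds for all x,y ∈ B if and only if ρ_{x·y} = ρ_yρ_x for all x,y ∈ B (ρ is an anti-homomorphism from (B,·) to Sym(B)). -/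

import Mathlib

/-- A skew left brace: two group operations `·` (mul) and `∘` (circ) on `B`
sharing the neutral element `1`, satisfying
`a ∘ (b · c) = (a ∘ b) · a⁻¹ · (a ∘ c)`. -/
structure SkewLeftBrace (B : Type*) where
  mul : B → B → B
  one : B
  inv : B → B
  circ : B → B → B
  oinv : B → B
  mul_assoc : ∀ a b c, mul (mul a b) c = mul a (mul b c)
  one_mul : ∀ a, mul one a = a
  mul_one : ∀ a, mul a one = a
  inv_mul : ∀ a, mul (inv a) a = one
  mul_inv : ∀ a, mul a (inv a) = one
  circ_assoc : ∀ a b c, circ (circ a b) c = circ a (circ b c)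
  one_circ : ∀ a, circ one a = a
  circ_one : ∀ a, circ a one = a
  oinv_circ : ∀ a, circ (oinv a) a = one
  circ_oinv : ∀ a, circ a (oinv a) = one
  compat : ∀ a b c, circ a (mul b c) = mul (mul (circ a b) (inv a)) (circ a c)

namespace SkewLeftBrace

variable {B : Type*}

/-- `λ_a(b) = a⁻¹ · (a ∘ b)`. -/
def lam (S : SkewLeftBrace B) (a b : B) : B := S.mul (S.inv a) (S.circ a b)

/-- `ρ_b(a) = (λ_a(b))‾ ∘ a ∘ b`, so that `(B, lam, rho)` is the solution
associated to the skew left brace. -/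
def rho (S : SkewLeftBrace B) (b a : B) : B :=
  S.circ (S.circ (S.oinv (S.lam a b)) a) b

/-- `(B, ·, ∘)` is a bi-skew left brace: `(B, ∘, ·)` is also a skew left brace,
i.e. `a · (b ∘ c) = (a · b) ∘ ā ∘ (a · c)`. -/
def IsBiSkew (S : SkewLeftBrace B) : Prop :=
  ∀ a b c, S.mul a (S.circ b c) =
    S.circ (S.circ (S.mul a b) (S.oinv a)) (S.mul a c)


variable {B : Type*}

/-! ### The associated solution -/

theorem mul_left_cancel (S : SkewLeftBrace B) {a b c : B} (h : S.mul a b = S.mul a c) :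
    b = c := by
  rw [← S.one_mul b, ← S.inv_mul a, S.mul_assoc, h, ← S.mul_assoc, S.inv_mul, S.one_mul]

theorem circ_left_cancel (S : SkewLeftBrace B) {a b c : B} (h : S.circ a b = S.circ a c) :
    b = c := by
  rw [← S.one_circ b, ← S.oinv_circ a, S.circ_assoc, h, ← S.circ_assoc, S.oinv_circ, S.one_circ]

theorem mul_lam (S : SkewLeftBrace B) (a b : B) : S.mul a (S.lam a b) = S.circ a b := by
  rw [lam, ← S.mul_assoc, S.mul_inv, S.one_mul]

theorem circ_lam_rho (S : SkewLeftBrace B) (a b : B) :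
    S.circ (S.lam a b) (S.rho b a) = S.circ a b := by
  rw [rho, S.circ_assoc, ← S.circ_assoc, S.circ_oinv, S.one_circ]

theorem lam_mul (S : SkewLeftBrace B) (a b c : B) :
    S.lam a (S.mul b c) = S.mul (S.lam a b) (S.lam a c) := by
  simp only [lam, S.compat, S.mul_assoc]

theorem lam_circ (S : SkewLeftBrace B) (a b : B) :
    S.lam (S.circ a b) = S.lam a ∘ S.lam b := by
  funext c
  apply S.mul_left_cancel (a := S.circ a b)
  rw [mul_lam, ← mul_lam S a b, S.mul_assoc, Function.comp_apply, ← lam_mul, mul_lam, mul_lam,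
    mul_lam, S.circ_assoc]

theorem lam_one_left (S : SkewLeftBrace B) : S.lam S.one = id := by
  funext a
  apply S.mul_left_cancel (a := S.one)
  rw [mul_lam, S.one_circ, S.one_mul, id]

theorem lam_one_right (S : SkewLeftBrace B) (a : B) : S.lam a S.one = S.one := by
  rw [lam, S.circ_one, S.inv_mul]

theorem lam_comp_lam_oinv (S : SkewLeftBrace B) (a : B) : S.lam a ∘ S.lam (S.oinv a) = id := by
  rw [← lam_circ, S.circ_oinv, lam_one_left]

theorem lam_surjective (S : SkewLeftBrace B) (a : B) : Function.Surjective (S.lam a) :=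
  fun b => ⟨_, congrFun (S.lam_comp_lam_oinv a) b⟩

theorem lam_injective (S : SkewLeftBrace B) (a : B) : Function.Injective (S.lam a) := by
  have h : S.lam (S.oinv a) ∘ S.lam a = id := by
    rw [← lam_circ, S.oinv_circ, lam_one_left]
  exact Function.LeftInverse.injective (congrFun h)

theorem lam_circ_right (S : SkewLeftBrace B) (a b c : B) :
    S.lam a (S.circ b c) = S.circ (S.lam a b) (S.lam (S.rho b a) c) := by
  rw [← mul_lam S (S.lam a b), ← Function.comp_apply (f := S.lam (S.lam a b)), ← lam_circ,
    circ_lam_rho, lam_circ, Function.comp_apply, ← lam_mul, mul_lam]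

theorem rho_circ (S : SkewLeftBrace B) (b c : B) :
    S.rho (S.circ b c) = S.rho c ∘ S.rho b := by
  funext a
  apply S.circ_left_cancel (a := S.lam a (S.circ b c))
  rw [circ_lam_rho, lam_circ_right, S.circ_assoc, Function.comp_apply, circ_lam_rho,
    ← S.circ_assoc (S.lam a b), circ_lam_rho, S.circ_assoc]

theorem rho_one (S : SkewLeftBrace B) : S.rho S.one = id := by
  funext a
  apply S.circ_left_cancel (a := S.lam a S.one)
  rw [circ_lam_rho, lam_one_right, S.circ_one, S.one_circ, id]

theorem rho_surjective (S : SkewLeftBrace B) (b : B) : Function.Surjective (S.rho b) := by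
  have h : S.rho b ∘ S.rho (S.oinv b) = id := by
    rw [← rho_circ, S.oinv_circ, rho_one]
  exact fun a => ⟨_, congrFun h a⟩

/-- Since `λ_x` is surjective and `x · λ_x(y) = x ∘ y`, an identity in `x · y` and `y` may be
checked on `x ∘ y` and `λ_x(y)`. -/
theorem forall_mul_iff_forall_circ (S : SkewLeftBrace B) (P : B → B → B → Prop) :
    (∀ x y, P x y (S.mul x y)) ↔ ∀ x y, P x (S.lam x y) (S.circ x y) := by
  simp only [← mul_lam]
  exact forall_congr' fun x =>
    (S.lam_surjective x).forall (p := fun y => P x y (S.mul x y))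

/-- the four 2-reductivity identities for the associated solution
of a skew left brace correspond to `λ`/`ρ` being homomorphisms or
anti-homomorphisms from `(B,·)`. -/
theorem twoReductive_identities_iff_hom (S : SkewLeftBrace B) :
    ((∀ x y, S.lam (S.lam x y) = S.lam y) ↔
        (∀ x y, S.lam (S.mul x y) = S.lam x ∘ S.lam y)) ∧
    ((∀ x y, S.rho (S.rho x y) = S.rho y) ↔
        (∀ x y, S.rho (S.mul x y) = S.rho x ∘ S.rho y)) ∧
    ((∀ x y, S.lam (S.rho x y) = S.lam y) ↔
        (∀ x y, S.lam (S.mul x y) = S.lam y ∘ S.lam x)) ∧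
    ((∀ x y, S.rho (S.lam x y) = S.rho y) ↔
        (∀ x y, S.rho (S.mul x y) = S.rho y ∘ S.rho x)) := by
  rw [S.forall_mul_iff_forall_circ fun x y z => S.lam z = S.lam x ∘ S.lam y,
    S.forall_mul_iff_forall_circ fun x y z => S.rho z = S.rho x ∘ S.rho y,
    S.forall_mul_iff_forall_circ fun x y z => S.lam z = S.lam y ∘ S.lam x,
    S.forall_mul_iff_forall_circ fun x y z => S.rho z = S.rho y ∘ S.rho x]
  refine ⟨forall₂_congr fun x y => ?_, forall_comm.trans (forall₂_congr fun x y => ?_),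
    forall_comm.trans (forall₂_congr fun x y => ?_), forall₂_congr fun x y => ?_⟩
  · rw [lam_circ, (S.lam_injective x).comp_left.eq_iff, eq_comm]
  · rw [← circ_lam_rho, rho_circ, (S.rho_surjective _).injective_comp_right.eq_iff]
  · rw [← circ_lam_rho, lam_circ, (S.lam_injective _).comp_left.eq_iff]
  · rw [rho_circ, (S.rho_surjective x).injective_comp_right.eq_iff, eq_comm]
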